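/- Let μ be a nonzero finite positive Borel measure on the unit circle ∂𝔻, let n be a nonnegative integer, and let dν(z) = P_μ(z) dA(z) on 𝔻. For α sufficiently large (depending on n), the integral operator T f(z) = ∫_𝔻 H(z,w) f(w) dν(w) with kernel H(z,w) = (1−|z|²)^n (1−|w|²)^α / (|1−zw̄|^{2+n+α} P_μ(w)) is bounded on L²(𝔻, dν); more precisely, this holds whenever there exist constants σ with σ < n, α > σ+1 and α+σ > −1. -/

import Mathlib

open MeasureTheory

noncomputable section

/-- The Poisson integral `P_μ(z) = (1/2π) ∫_{∂𝔻} (1-|z|²)/|ζ-z|² dμ(ζ)` of a measure `μ`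
on the unit circle. -/
def poissonInt (μ : Measure ℂ) (z : ℂ) : ℝ :=
  (2 * Real.pi)⁻¹ * ∫ ζ, (1 - ‖z‖ ^ 2) / ‖ζ - z‖ ^ 2 ∂μ

/-- The measure `dν(z) = P_μ(z) dA(z)` on the unit disc. -/
def nuMeas (μ : Measure ℂ) : Measure ℂ :=
  (volume.restrict (Metric.ball (0:ℂ) 1)).withDensity
    fun z => ENNReal.ofReal (poissonInt μ z)

/-- The kernel `H(z,w) = (1-|z|²)ⁿ (1-|w|²)^α / (|1-zw̄|^{2+n+α} P_μ(w))`. -/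
def kernH (μ : Measure ℂ) (n : ℕ) (α : ℝ) (z w : ℂ) : ℝ :=
  (1 - ‖z‖ ^ 2) ^ (n : ℝ) * (1 - ‖w‖ ^ 2) ^ α /
    (‖1 - z * (starRingEnd ℂ) w‖ ^ (2 + (n : ℝ) + α) * poissonInt μ w)

open Set
open scoped Real ENNReal ComplexConjugate

lemma norm_one_sub_mul_conj_of_norm_eq_one {ζ : ℂ} (hζ : ‖ζ‖ = 1) (z : ℂ) :
    ‖1 - z * conj ζ‖ = ‖ζ - z‖ := by
  have h : ζ - z = ζ * (1 - z * conj ζ) := by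
    have : ζ * conj ζ = 1 := by rw [Complex.mul_conj']; simp [hζ]
    linear_combination z * this
  rw [h, norm_mul, hζ, one_mul]

lemma lintegral_inv_norm_one_sub_exp_mul_sq {a : ℂ} (ha : ‖a‖ < 1) :
    ∫⁻ θ in Ioo (-π) π, ENNReal.ofReal (‖1 - Complex.exp (θ * Complex.I) * conj a‖ ^ 2)⁻¹
      = ENNReal.ofReal (2 * π / (1 - ‖a‖ ^ 2)) := by
  have hne : ∀ θ : ℝ, 1 - Complex.exp (θ * Complex.I) * conj a ≠ 0 := by
    intro θ h
    have h2 : ‖Complex.exp (θ * Complex.I) * conj a‖ = 1 := by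
      rw [← sub_eq_zero.1 h]; simp
    rw [norm_mul, Complex.norm_exp_ofReal_mul_I, RCLike.norm_conj] at h2
    linarith
  have hcont : Continuous fun θ : ℝ =>
      (‖1 - Complex.exp (θ * Complex.I) * conj a‖ ^ 2)⁻¹ := by
    refine Continuous.inv₀ (by fun_prop) fun θ => ?_
    simpa using hne θ
  have hpos : 0 < 1 - ‖a‖ ^ 2 := by nlinarith [norm_nonneg a]
  have hP : Real.circleAverage (poissonKernel 0 a • fun _ : ℂ => (1 : ℂ)) 0 1 = 1 :=
    DiffContOnCl.circleAverage_poissonKernel_smul (f := fun _ : ℂ => (1 : ℂ))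
      diffContOnCl_const (by simpa using ha)
  have hnorm : ∀ θ : ℝ, ‖1 - Complex.exp (θ * Complex.I) * conj a‖
      = ‖Complex.exp (θ * Complex.I) - a‖ := by
    intro θ
    rw [← norm_one_sub_mul_conj_of_norm_eq_one (Complex.norm_exp_ofReal_mul_I θ),
      ← RCLike.norm_conj]
    simp [mul_comm]
  have hint : ∫ θ in (0 : ℝ)..2 * π, (‖1 - Complex.exp (θ * Complex.I) * conj a‖ ^ 2)⁻¹
      = 2 * π / (1 - ‖a‖ ^ 2) := by
    rw [Real.circleAverage_def] at hP
    have e : ∀ θ : ℝ, (poissonKernel 0 a • fun _ : ℂ => (1 : ℂ)) (circleMap 0 1 θ)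
        = (((1 - ‖a‖ ^ 2) * (‖1 - Complex.exp (θ * Complex.I) * conj a‖ ^ 2)⁻¹ : ℝ) : ℂ) := by
      intro θ
      simp [poissonKernel, circleMap, hnorm, Complex.norm_exp_ofReal_mul_I, div_eq_mul_inv]
    simp_rw [e] at hP
    rw [intervalIntegral.integral_ofReal, intervalIntegral.integral_const_mul] at hP
    rw [Complex.real_smul] at hP
    have hP' : (2 * π)⁻¹ * ((1 - ‖a‖ ^ 2) *
      ∫ θ in (0 : ℝ)..2 * π, (‖1 - Complex.exp (θ * Complex.I) * conj a‖ ^ 2)⁻¹) = 1 := by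
      exact_mod_cast hP
    have := Real.pi_pos
    rw [inv_mul_eq_one₀ (by positivity)] at hP'
    rw [eq_div_iff hpos.ne', mul_comm]
    exact hP'.symm
  have hper : Function.Periodic (fun θ : ℝ =>
      (‖1 - Complex.exp (θ * Complex.I) * conj a‖ ^ 2)⁻¹) (2 * π) := by
    intro θ
    simp only [Complex.ofReal_add, Complex.ofReal_mul, Complex.ofReal_ofNat, add_mul,
      Complex.exp_add, Complex.exp_two_pi_mul_I, mul_one]
  rw [← ofReal_integral_eq_lintegral_ofReal, ← integral_Ioc_eq_integral_Ioo,
    ← intervalIntegral.integral_of_le (by linarith [Real.pi_pos])]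
  · congr 1
    rw [← hint]
    have := hper.intervalIntegral_add_eq (-π) 0
    rw [zero_add] at this
    rw [← this]
    congr 1
    ring
  · exact (hcont.integrableOn_Icc (a := -π) (b := π)).mono_set Ioo_subset_Icc_self
  · exact Filter.Eventually.of_forall fun θ => by positivity

lemma setLIntegral_ball_radial_mul_inv_norm_sq {u : ℂ} (hu : ‖u‖ ≤ 1) {F : ℝ → ℝ≥0∞}
    (hF : Measurable F) :
    ∫⁻ z in Metric.ball (0 : ℂ) 1, F (1 - ‖z‖ ^ 2) * ENNReal.ofReal (‖1 - z * conj u‖ ^ 2)⁻¹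
      = ∫⁻ r in Ioo (0 : ℝ) 1, ENNReal.ofReal r *
        (F (1 - r ^ 2) * ENNReal.ofReal (2 * π / (1 - (r * ‖u‖) ^ 2))) := by
  rw [← lintegral_indicator Metric.isOpen_ball.measurableSet,
    ← Complex.lintegral_comp_polarCoord_symm]
  have e : ∀ p ∈ polarCoord.target, ENNReal.ofReal p.1 •
      (Metric.ball (0 : ℂ) 1).indicator (fun z => F (1 - ‖z‖ ^ 2) *
        ENNReal.ofReal (‖1 - z * conj u‖ ^ 2)⁻¹) (Complex.polarCoord.symm p)
      = (Iio (1 : ℝ)).indicator (fun r => ENNReal.ofReal r * F (1 - r ^ 2)) p.1 *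
        ENNReal.ofReal (‖1 - Complex.exp (p.2 * Complex.I) * conj ((p.1 : ℂ) * u)‖ ^ 2)⁻¹ := by
    rintro ⟨r, θ⟩ hp
    have hr : 0 < r := hp.1
    have hz : Complex.polarCoord.symm (r, θ) = r * Complex.exp (θ * Complex.I) := by
      rw [Complex.polarCoord_symm_apply, Complex.exp_mul_I]; simp
    have hn : ‖(r : ℂ) * Complex.exp (θ * Complex.I)‖ = r := by
      simp [Complex.norm_exp_ofReal_mul_I, abs_of_pos hr]
    rw [hz]
    by_cases h : r < 1
    · rw [indicator_of_mem (by rw [mem_ball_zero_iff, hn]; exact h), indicator_of_mem (by simpa using h), hn,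
        smul_eq_mul, ← mul_assoc, map_mul, Complex.conj_ofReal, mul_comm (r : ℂ) (Complex.exp _),
        mul_assoc (Complex.exp _)]
    · rw [indicator_of_notMem (by rw [mem_ball_zero_iff, hn]; exact h), indicator_of_notMem (by simpa using h)]
      simp
  rw [setLIntegral_congr_fun polarCoord.open_target.measurableSet e]
  have ht : polarCoord.target = Ioi (0 : ℝ) ×ˢ Ioo (-π) π := rfl
  rw [ht, Measure.volume_eq_prod, ← Measure.prod_restrict, lintegral_prod _ (by
    refine Measurable.aemeasurable ?_
    refine Measurable.mul ?_ (by fun_prop)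
    exact Measurable.comp (Measurable.indicator (by fun_prop) measurableSet_Iio) measurable_fst)]
  have e2 : ∀ r ∈ Ioi (0 : ℝ), (∫⁻ θ in Ioo (-π) π,
      (Iio (1 : ℝ)).indicator (fun r => ENNReal.ofReal r * F (1 - r ^ 2)) r *
        ENNReal.ofReal (‖1 - Complex.exp (θ * Complex.I) * conj ((r : ℂ) * u)‖ ^ 2)⁻¹)
      = (Iio (1 : ℝ)).indicator (fun r => ENNReal.ofReal r *
        (F (1 - r ^ 2) * ENNReal.ofReal (2 * π / (1 - (r * ‖u‖) ^ 2)))) r := by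
    intro r hr
    rw [lintegral_const_mul _ (by fun_prop)]
    by_cases h : r < 1
    · have hn : ‖(r : ℂ) * u‖ = r * ‖u‖ := by simp [abs_of_pos (mem_Ioi.1 hr)]
      rw [lintegral_inv_norm_one_sub_exp_mul_sq, indicator_of_mem (by simpa using h),
        indicator_of_mem (by simpa using h), hn, mul_assoc]
      rw [hn]
      have : 0 < r := hr
      nlinarith [norm_nonneg u]
    · rw [indicator_of_notMem (by simpa using h), indicator_of_notMem (by simpa using h), zero_mul]
  rw [setLIntegral_congr_fun measurableSet_Ioi e2, lintegral_indicator measurableSet_Iio,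
    Measure.restrict_restrict measurableSet_Iio]
  congr 2
  ext; simp [and_comm]

lemma setLIntegral_Ioo_mul_comp_one_sub_sq_le (G : ℝ → ℝ≥0∞) :
    ∫⁻ r in Ioo (0 : ℝ) 1, ENNReal.ofReal r * G (1 - r ^ 2) ≤ ∫⁻ t in Ioi (0 : ℝ), G t := by
  have h := lintegral_image_eq_lintegral_abs_deriv_mul (s := Ioo (0 : ℝ) 1)
    (f := fun r => 1 - r ^ 2) (f' := fun r => -(2 * r)) measurableSet_Ioo
    (fun x _ => by
      have := ((hasDerivAt_pow 2 x).const_sub 1).hasDerivWithinAt (s := Ioo (0 : ℝ) 1)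
      simpa using this)
    (fun x hx y hy hxy => by
      have : x ^ 2 = y ^ 2 := by simpa using hxy
      nlinarith [hx.1, hy.1]) G
  calc _ ≤ ∫⁻ r in Ioo (0 : ℝ) 1, ENNReal.ofReal |-(2 * r)| * G (1 - r ^ 2) := by
        refine setLIntegral_mono' measurableSet_Ioo fun r hr => ?_
        gcongr
        rw [abs_neg, abs_of_pos (by linarith [hr.1])]
        linarith [hr.1]
    _ = _ := h.symm
    _ ≤ _ := by
        refine lintegral_mono_set ?_
        rintro _ ⟨r, hr, rfl⟩
        have := hr.1
        have := hr.2
        simp only [mem_Ioi]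
        nlinarith

lemma lintegral_rpow_mul_max_rpow_le {s b : ℝ} (hs : -1 < s) (hb : s + 1 < b) {δ : ℝ}
    (hδ : 0 < δ) :
    ∫⁻ t in Ioi (0 : ℝ), ENNReal.ofReal (t ^ s * max t δ ^ (-b))
      ≤ ENNReal.ofReal ((1 / (s + 1) + 1 / (b - s - 1)) * δ ^ (s + 1 - b)) := by
  have hU : Ioi (0 : ℝ) = Ioc 0 δ ∪ Ioi δ := (Ioc_union_Ioi_eq_Ioi hδ.le).symm
  have h1 : ∫⁻ t in Ioc (0 : ℝ) δ, ENNReal.ofReal (t ^ s * max t δ ^ (-b))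
      = ENNReal.ofReal (1 / (s + 1) * δ ^ (s + 1 - b)) := by
    rw [setLIntegral_congr_fun (g := fun t => ENNReal.ofReal (t ^ s * δ ^ (-b)))
      measurableSet_Ioc (fun t ht => by simp only [max_eq_right ht.2])]
    rw [← ofReal_integral_eq_lintegral_ofReal]
    · rw [integral_mul_const, ← intervalIntegral.integral_of_le hδ.le, integral_rpow (Or.inl hs),
        Real.zero_rpow (by linarith), sub_zero, sub_eq_add_neg (s + 1), Real.rpow_add hδ (s + 1) (-b)]
      congr 1; ring
    · refine Integrable.mul_const ?_ _
      have := intervalIntegral.intervalIntegrable_rpow' (a := 0) (b := δ) hs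
      rwa [intervalIntegrable_iff_integrableOn_Ioc_of_le hδ.le] at this
    · refine (ae_restrict_mem measurableSet_Ioc).mono fun t ht => ?_
      have := ht.1
      simp only [Pi.zero_apply]; positivity
  have h2 : ∫⁻ t in Ioi δ, ENNReal.ofReal (t ^ s * max t δ ^ (-b))
      = ENNReal.ofReal (1 / (b - s - 1) * δ ^ (s + 1 - b)) := by
    rw [setLIntegral_congr_fun (g := fun t => ENNReal.ofReal (t ^ (s - b)))
      measurableSet_Ioi (fun t ht => by
        have ht' : δ < t := ht
        simp only [max_eq_left ht'.le, sub_eq_add_neg, Real.rpow_add (hδ.trans ht')])]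
    rw [← ofReal_integral_eq_lintegral_ofReal]
    · rw [integral_Ioi_rpow_of_lt (by linarith) hδ]
      congr 1
      rw [show s - b + 1 = s + 1 - b by ring, show b - s - 1 = -(s + 1 - b) by ring]
      rw [one_div, inv_neg]; ring
    · exact integrableOn_Ioi_rpow_of_lt (by linarith) hδ
    · refine (ae_restrict_mem measurableSet_Ioi).mono fun t ht => ?_
      have := hδ.trans (mem_Ioi.1 ht)
      simp only [Pi.zero_apply]; positivity
  rw [hU]
  refine (lintegral_union_le _ _ _).trans ?_
  have : 0 < s + 1 := by linarith
  have : 0 < b - s - 1 := by linarith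
  rw [h1, h2, ← ENNReal.ofReal_add (by positivity) (by positivity), add_mul]

lemma one_sub_norm_sq_pos {z : ℂ} (hz : ‖z‖ < 1) : 0 < 1 - ‖z‖ ^ 2 := by
  nlinarith [norm_nonneg z]

lemma max_le_one_sub_mul_sq {r ρ : ℝ} (hr : 0 ≤ r) (hr1 : r ≤ 1) (hρ : 0 ≤ ρ) (hρ1 : ρ ≤ 1) :
    max (1 - r ^ 2) (1 - ρ ^ 2) ≤ 1 - (r * ρ) ^ 2 := by
  have h1 : r ^ 2 ≤ 1 := by nlinarith
  have h2 : ρ ^ 2 ≤ 1 := by nlinarith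
  refine max_le ?_ ?_ <;> nlinarith [sq_nonneg r, sq_nonneg ρ]

lemma max_le_two_mul_norm_one_sub_mul_conj {z w : ℂ} (hz : ‖z‖ < 1) (hw : ‖w‖ < 1) :
    max (1 - ‖z‖ ^ 2) (1 - ‖w‖ ^ 2) ≤ 2 * ‖1 - z * conj w‖ := by
  have h1 := max_le_one_sub_mul_sq (norm_nonneg z) hz.le (norm_nonneg w) hw.le
  have h2 : 1 - ‖z‖ * ‖w‖ ≤ ‖1 - z * conj w‖ := by
    have := norm_sub_norm_le (1 : ℂ) (z * conj w)
    simpa using this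
  have h3 : ‖z‖ * ‖w‖ ≤ 1 := by nlinarith [norm_nonneg z, norm_nonneg w]
  nlinarith [mul_nonneg (norm_nonneg z) (norm_nonneg w)]

lemma norm_one_sub_mul_conj_pos {z w : ℂ} (hz : ‖z‖ < 1) (hw : ‖w‖ < 1) :
    0 < ‖1 - z * conj w‖ := by
  have := max_le_two_mul_norm_one_sub_mul_conj hz hw
  have := le_max_left (1 - ‖z‖ ^ 2) (1 - ‖w‖ ^ 2)
  linarith [one_sub_norm_sq_pos hz]

lemma norm_sub_le_norm_one_sub_mul_conj {z w : ℂ} (hz : ‖z‖ < 1) (hw : ‖w‖ < 1) :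
    ‖z - w‖ ≤ ‖1 - z * conj w‖ := by
  have key : ‖1 - z * conj w‖ ^ 2 = ‖z - w‖ ^ 2 + (1 - ‖z‖ ^ 2) * (1 - ‖w‖ ^ 2) := by
    simp only [← Complex.normSq_eq_norm_sq, Complex.normSq_apply]
    simp
    ring
  refine le_of_sq_le_sq ?_ (norm_nonneg _)
  nlinarith [mul_pos (one_sub_norm_sq_pos hz) (one_sub_norm_sq_pos hw)]

/-- If the angular mean of a radial weight against `|1 - z ū|⁻²` is dominated by
`t ^ s * max t δ ^ (-b)` with `t = 1 - |z|²`, its integral over the disc is `O(δ ^ (s + 1 - b))`. -/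
lemma setLIntegral_ball_radial_le {s b δ : ℝ} (hs : -1 < s) (hb : s + 1 < b) (hδ : 0 < δ)
    {u : ℂ} (hu : ‖u‖ ≤ 1) {F : ℝ → ℝ} (hF : Measurable F) (hF0 : ∀ t, 0 < t → 0 ≤ F t)
    (hFle : ∀ r, 0 < r → r < 1 → F (1 - r ^ 2) / (1 - (r * ‖u‖) ^ 2)
      ≤ (1 - r ^ 2) ^ s * max (1 - r ^ 2) δ ^ (-b)) :
    ∫⁻ z in Metric.ball (0 : ℂ) 1, ENNReal.ofReal (F (1 - ‖z‖ ^ 2) * (‖1 - z * conj u‖ ^ 2)⁻¹)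
      ≤ ENNReal.ofReal (2 * π * ((1 / (s + 1) + 1 / (b - s - 1)) * δ ^ (s + 1 - b))) := by
  have hpi := Real.pi_pos
  calc _ = ∫⁻ z in Metric.ball (0 : ℂ) 1, (fun t => ENNReal.ofReal (F t)) (1 - ‖z‖ ^ 2) *
          ENNReal.ofReal (‖1 - z * conj u‖ ^ 2)⁻¹ := by
        refine setLIntegral_congr_fun Metric.isOpen_ball.measurableSet fun z hz => ?_
        rw [mem_ball_zero_iff] at hz
        exact ENNReal.ofReal_mul (hF0 _ (one_sub_norm_sq_pos hz))
    _ = ∫⁻ r in Ioo (0 : ℝ) 1, ENNReal.ofReal r * (ENNReal.ofReal (F (1 - r ^ 2)) *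
          ENNReal.ofReal (2 * π / (1 - (r * ‖u‖) ^ 2))) :=
        setLIntegral_ball_radial_mul_inv_norm_sq hu hF.ennreal_ofReal
    _ ≤ ∫⁻ r in Ioo (0 : ℝ) 1, ENNReal.ofReal r * (fun t => ENNReal.ofReal (2 * π) *
          ENNReal.ofReal (t ^ s * max t δ ^ (-b))) (1 - r ^ 2) := by
        refine setLIntegral_mono' measurableSet_Ioo fun r hr => ?_
        have hr2 : 0 < 1 - r ^ 2 := by nlinarith [hr.1, hr.2]
        refine mul_le_mul_right ?_ _
        beta_reduce
        rw [← ENNReal.ofReal_mul (hF0 _ hr2), ← ENNReal.ofReal_mul (by positivity)]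
        refine ENNReal.ofReal_le_ofReal ?_
        have := mul_le_mul_of_nonneg_left (hFle r hr.1 hr.2) (by positivity : 0 ≤ 2 * π)
        refine le_trans (le_of_eq ?_) this
        ring
    _ ≤ _ := setLIntegral_Ioo_mul_comp_one_sub_sq_le _
    _ = ENNReal.ofReal (2 * π) *
          ∫⁻ t in Ioi (0 : ℝ), ENNReal.ofReal (t ^ s * max t δ ^ (-b)) :=
        lintegral_const_mul _ (by fun_prop)
    _ ≤ ENNReal.ofReal (2 * π) * _ :=
        mul_le_mul_right (lintegral_rpow_mul_max_rpow_le hs hb hδ) _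
    _ = _ := (ENNReal.ofReal_mul (by positivity)).symm

lemma rpow_neg_norm_le {p : ℝ} (hp : 0 ≤ p) {z w : ℂ} (hz : ‖z‖ < 1) (hw : ‖w‖ < 1) :
    ‖1 - z * conj w‖ ^ (-p) ≤ 2 ^ p * max (1 - ‖z‖ ^ 2) (1 - ‖w‖ ^ 2) ^ (-p) := by
  have hM : 0 < max (1 - ‖z‖ ^ 2) (1 - ‖w‖ ^ 2) := lt_max_of_lt_left (one_sub_norm_sq_pos hz)
  have h := max_le_two_mul_norm_one_sub_mul_conj hz hw
  have h2 := Real.rpow_le_rpow_of_nonpos hM h (neg_nonpos.2 hp)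
  rw [Real.mul_rpow (by norm_num) (norm_nonneg _)] at h2
  calc _ = 2 ^ p * (2 ^ (-p) * ‖1 - z * conj w‖ ^ (-p)) := by
        rw [← mul_assoc, ← Real.rpow_add two_pos]; simp
    _ ≤ _ := by gcongr

/-- The Forelli–Rudin estimate on the unit disc. -/
lemma exists_forelliRudin_bound {s b : ℝ} (hs : -1 < s) (hb : s + 1 < b) (hb1 : 1 ≤ b) :
    ∃ C : ℝ, 0 < C ∧ ∀ w : ℂ, ‖w‖ < 1 →
      ∫⁻ z in Metric.ball (0 : ℂ) 1,
        ENNReal.ofReal ((1 - ‖z‖ ^ 2) ^ s * ‖1 - z * conj w‖ ^ (-(b + 1)))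
      ≤ ENNReal.ofReal (C * (1 - ‖w‖ ^ 2) ^ (s + 1 - b)) := by
  have hpi := Real.pi_pos
  have h1 : 0 < s + 1 := by linarith
  have h2 : 0 < b - s - 1 := by linarith
  refine ⟨2 ^ (b - 1) * (2 * π * (1 / (s + 1) + 1 / (b - s - 1))), by positivity,
    fun w hw => ?_⟩
  have hδ := one_sub_norm_sq_pos hw
  have hmain := setLIntegral_ball_radial_le hs hb hδ hw.le
    (F := fun t => t ^ s * max t (1 - ‖w‖ ^ 2) ^ (-(b - 1))) (by fun_prop)
    (fun t ht => by positivity) (fun r hr hr1 => by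
      have hr2 : 0 < 1 - r ^ 2 := by nlinarith
      have hM : 0 < max (1 - r ^ 2) (1 - ‖w‖ ^ 2) := lt_max_of_lt_left hr2
      have hle := max_le_one_sub_mul_sq hr.le hr1.le (norm_nonneg w) hw.le
      calc _ ≤ (1 - r ^ 2) ^ s * max (1 - r ^ 2) (1 - ‖w‖ ^ 2) ^ (-(b - 1)) /
            max (1 - r ^ 2) (1 - ‖w‖ ^ 2) := by gcongr
        _ = _ := by
          rw [mul_div_assoc, ← Real.rpow_sub_one hM.ne']
          congr 2; ring)
  calc _ ≤ ∫⁻ z in Metric.ball (0 : ℂ) 1, ENNReal.ofReal (2 ^ (b - 1)) *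
        ENNReal.ofReal ((1 - ‖z‖ ^ 2) ^ s * max (1 - ‖z‖ ^ 2) (1 - ‖w‖ ^ 2) ^ (-(b - 1)) *
          (‖1 - z * conj w‖ ^ 2)⁻¹) := by
        refine setLIntegral_mono' Metric.isOpen_ball.measurableSet fun z hz => ?_
        rw [mem_ball_zero_iff] at hz
        rw [← ENNReal.ofReal_mul (by positivity)]
        refine ENNReal.ofReal_le_ofReal ?_
        have hz0 := one_sub_norm_sq_pos hz
        have hA := norm_one_sub_mul_conj_pos hz hw
        have := rpow_neg_norm_le (sub_nonneg.2 hb1) hz hw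
        calc _ = (1 - ‖z‖ ^ 2) ^ s * (‖1 - z * conj w‖ ^ (-(b - 1)) *
              (‖1 - z * conj w‖ ^ 2)⁻¹) := by
              rw [← Real.rpow_natCast ‖1 - z * conj w‖ 2, ← Real.rpow_neg hA.le, ← Real.rpow_add hA]
              congr 2; push_cast; ring
          _ ≤ (1 - ‖z‖ ^ 2) ^ s * ((2 ^ (b - 1) *
              max (1 - ‖z‖ ^ 2) (1 - ‖w‖ ^ 2) ^ (-(b - 1))) * (‖1 - z * conj w‖ ^ 2)⁻¹) := by
              gcongr
          _ = _ := by ring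
    _ = ENNReal.ofReal (2 ^ (b - 1)) * _ := lintegral_const_mul _ (by fun_prop)
    _ ≤ ENNReal.ofReal (2 ^ (b - 1)) * _ := mul_le_mul_right hmain _
    _ = _ := by
        rw [← ENNReal.ofReal_mul (by positivity)]
        congr 1; ring

/-- A Forelli–Rudin estimate with an extra Poisson-type singularity at a boundary point. -/
lemma exists_forelliRudin_poisson_bound {s b : ℝ} (hs : 0 < s) (hb : s + 1 < b) :
    ∃ C : ℝ, 0 < C ∧ ∀ w : ℂ, ‖w‖ < 1 → ∀ ζ : ℂ, ‖ζ‖ = 1 →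
      ∫⁻ z in Metric.ball (0 : ℂ) 1, ENNReal.ofReal
        ((1 - ‖z‖ ^ 2) ^ s * ‖1 - z * conj w‖ ^ (-(b + 1)) * (‖ζ - z‖ ^ 2)⁻¹)
      ≤ ENNReal.ofReal (C * (1 - ‖w‖ ^ 2) ^ (s + 1 - b) * (‖ζ - w‖ ^ 2)⁻¹) := by
  have hpi := Real.pi_pos
  obtain ⟨C₁, hC₁, hFR⟩ := exists_forelliRudin_bound (s := s) (b := b) (by linarith) hb
    (by linarith)
  have h1 : 0 < s - 1 + 1 := by linarith
  have h2 : 0 < b - 1 - (s - 1) - 1 := by linarith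
  set K : ℝ := 2 * π * (1 / (s - 1 + 1) + 1 / (b - 1 - (s - 1) - 1)) with hK
  have hKpos : 0 < K := by positivity
  refine ⟨2 * C₁ + 2 * (2 ^ (b - 1) * K), by positivity, fun w hw ζ hζ => ?_⟩
  have hδ := one_sub_norm_sq_pos hw
  have hmain := setLIntegral_ball_radial_le (s := s - 1) (b := b - 1) (by linarith)
    (by linarith) hδ hζ.le
    (F := fun t => t ^ s * max t (1 - ‖w‖ ^ 2) ^ (-(b - 1))) (by fun_prop)
    (fun t ht => by positivity) (fun r hr hr1 => by
      have hr2 : 0 < 1 - r ^ 2 := by nlinarith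
      rw [hζ, mul_one, Real.rpow_sub_one hr2.ne']
      apply le_of_eq; ring)
  simp_rw [norm_one_sub_mul_conj_of_norm_eq_one hζ] at hmain
  have hζw : 0 < ‖ζ - w‖ := norm_pos_iff.2 (sub_ne_zero.2 (by rintro rfl; linarith))
  calc _ ≤ ∫⁻ z in Metric.ball (0 : ℂ) 1, (ENNReal.ofReal (2 * (‖ζ - w‖ ^ 2)⁻¹) *
          ENNReal.ofReal ((1 - ‖z‖ ^ 2) ^ s * ‖1 - z * conj w‖ ^ (-(b + 1)))
        + ENNReal.ofReal (2 * (‖ζ - w‖ ^ 2)⁻¹ * 2 ^ (b - 1)) *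
          ENNReal.ofReal ((1 - ‖z‖ ^ 2) ^ s *
            max (1 - ‖z‖ ^ 2) (1 - ‖w‖ ^ 2) ^ (-(b - 1)) * (‖ζ - z‖ ^ 2)⁻¹)) := by
        refine setLIntegral_mono' Metric.isOpen_ball.measurableSet fun z hz => ?_
        rw [mem_ball_zero_iff] at hz
        have hz0 := one_sub_norm_sq_pos hz
        have hA := norm_one_sub_mul_conj_pos hz hw
        have hB : 0 < ‖ζ - z‖ := norm_pos_iff.2 (sub_ne_zero.2 (by rintro rfl; linarith))
        have hle := rpow_neg_norm_le (p := b - 1) (by linarith) hz hw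
        rw [← ENNReal.ofReal_mul (by positivity), ← ENNReal.ofReal_mul (by positivity),
          ← ENNReal.ofReal_add (by positivity) (by positivity)]
        refine ENNReal.ofReal_le_ofReal ?_
        have htri : ‖ζ - w‖ ≤ ‖ζ - z‖ + ‖1 - z * conj w‖ := by
          have := norm_sub_le_norm_sub_add_norm_sub ζ z w
          linarith [norm_sub_le_norm_one_sub_mul_conj hz hw]
        have hsq : ‖ζ - w‖ ^ 2 ≤ 2 * ‖ζ - z‖ ^ 2 + 2 * ‖1 - z * conj w‖ ^ 2 := by
          nlinarith [sq_nonneg (‖ζ - z‖ - ‖1 - z * conj w‖)]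
        have hinv : (‖ζ - z‖ ^ 2)⁻¹ ≤ 2 * (‖ζ - w‖ ^ 2)⁻¹ +
            2 * (‖ζ - w‖ ^ 2)⁻¹ * ‖1 - z * conj w‖ ^ 2 * (‖ζ - z‖ ^ 2)⁻¹ := by
          have e : 2 * (‖ζ - w‖ ^ 2)⁻¹ +
              2 * (‖ζ - w‖ ^ 2)⁻¹ * ‖1 - z * conj w‖ ^ 2 * (‖ζ - z‖ ^ 2)⁻¹
              = ((2 * ‖ζ - z‖ ^ 2 + 2 * ‖1 - z * conj w‖ ^ 2) / ‖ζ - w‖ ^ 2) *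
                (‖ζ - z‖ ^ 2)⁻¹ := by field_simp
          rw [e]
          refine le_mul_of_one_le_left (by positivity) ?_
          rwa [one_le_div (by positivity)]
        have hpow : ‖1 - z * conj w‖ ^ (-(b + 1)) * ‖1 - z * conj w‖ ^ 2
            = ‖1 - z * conj w‖ ^ (-(b - 1)) := by
          rw [← Real.rpow_natCast, ← Real.rpow_add hA]
          congr 1; push_cast; ring
        calc _ ≤ (1 - ‖z‖ ^ 2) ^ s * ‖1 - z * conj w‖ ^ (-(b + 1)) *
              (2 * (‖ζ - w‖ ^ 2)⁻¹ +
                2 * (‖ζ - w‖ ^ 2)⁻¹ * ‖1 - z * conj w‖ ^ 2 * (‖ζ - z‖ ^ 2)⁻¹) := by gcongr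
          _ = 2 * (‖ζ - w‖ ^ 2)⁻¹ * ((1 - ‖z‖ ^ 2) ^ s * ‖1 - z * conj w‖ ^ (-(b + 1))) +
              2 * (‖ζ - w‖ ^ 2)⁻¹ * ((1 - ‖z‖ ^ 2) ^ s *
                (‖1 - z * conj w‖ ^ (-(b + 1)) * ‖1 - z * conj w‖ ^ 2) *
                (‖ζ - z‖ ^ 2)⁻¹) := by ring
          _ ≤ 2 * (‖ζ - w‖ ^ 2)⁻¹ * ((1 - ‖z‖ ^ 2) ^ s * ‖1 - z * conj w‖ ^ (-(b + 1))) +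
              2 * (‖ζ - w‖ ^ 2)⁻¹ * ((1 - ‖z‖ ^ 2) ^ s *
                (2 ^ (b - 1) * max (1 - ‖z‖ ^ 2) (1 - ‖w‖ ^ 2) ^ (-(b - 1))) *
                (‖ζ - z‖ ^ 2)⁻¹) := by rw [hpow]; gcongr
          _ = _ := by ring
    _ = ENNReal.ofReal (2 * (‖ζ - w‖ ^ 2)⁻¹) * (∫⁻ z in Metric.ball (0 : ℂ) 1,
          ENNReal.ofReal ((1 - ‖z‖ ^ 2) ^ s * ‖1 - z * conj w‖ ^ (-(b + 1)))) +
        ENNReal.ofReal (2 * (‖ζ - w‖ ^ 2)⁻¹ * 2 ^ (b - 1)) *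
          ∫⁻ z in Metric.ball (0 : ℂ) 1, ENNReal.ofReal ((1 - ‖z‖ ^ 2) ^ s *
            max (1 - ‖z‖ ^ 2) (1 - ‖w‖ ^ 2) ^ (-(b - 1)) * (‖ζ - z‖ ^ 2)⁻¹) := by
        rw [lintegral_add_left (by fun_prop), lintegral_const_mul _ (by fun_prop),
          lintegral_const_mul _ (by fun_prop)]
    _ ≤ ENNReal.ofReal (2 * (‖ζ - w‖ ^ 2)⁻¹) * _ +
        ENNReal.ofReal (2 * (‖ζ - w‖ ^ 2)⁻¹ * 2 ^ (b - 1)) * _ :=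
        add_le_add (mul_le_mul_right (hFR w hw) _) (mul_le_mul_right hmain _)
    _ = _ := by
        rw [← ENNReal.ofReal_mul (by positivity), ← ENNReal.ofReal_mul (by positivity),
          ← ENNReal.ofReal_add (by positivity) (by positivity)]
        congr 1
        rw [show s - 1 + 1 - (b - 1) = s + 1 - b by ring, ← mul_assoc (2 * π), ← hK]
        ring

/-- Schur's test on `L²` for nonnegative kernels. -/
lemma lintegral_sq_lintegral_mul_le_of_schur {X : Type*} [MeasurableSpace X] {ν : Measure X}
    [SFinite ν] {H : X → X → ℝ≥0∞} (hH : Measurable (Function.uncurry H)) {h : X → ℝ≥0∞}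
    (hh : Measurable h) (h0 : ∀ᵐ x ∂ν, h x ≠ 0) (htop : ∀ᵐ x ∂ν, h x ≠ ∞) {A B : ℝ≥0∞}
    (hA : ∀ᵐ z ∂ν, ∫⁻ w, H z w * h w ∂ν ≤ A * h z)
    (hB : ∀ᵐ w ∂ν, ∫⁻ z, H z w * h z ∂ν ≤ B * h w)
    {g : X → ℝ≥0∞} (hg : Measurable g) :
    ∫⁻ z, (∫⁻ w, H z w * g w ∂ν) ^ 2 ∂ν ≤ A * B * ∫⁻ w, g w ^ 2 ∂ν := by
  have hHz : ∀ z, Measurable (H z) := fun z => hH.comp measurable_prodMk_left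
  have hHw : ∀ w, Measurable (fun z => H z w) := fun w => hH.comp measurable_prodMk_right
  have hCS : ∀ z, (∫⁻ w, H z w * g w ∂ν) ^ 2
      ≤ (∫⁻ w, H z w * h w ∂ν) * ∫⁻ w, H z w * (g w ^ 2 / h w) ∂ν := by
    intro z
    have hH2 := ENNReal.lintegral_mul_le_Lp_mul_Lq ν Real.HolderConjugate.two_two
      (f := fun w => (H z w * h w) ^ (1 / 2 : ℝ))
      (g := fun w => (H z w * (g w ^ 2 / h w)) ^ (1 / 2 : ℝ))
      (by fun_prop) (by fun_prop)
    simp only [← ENNReal.rpow_mul] at hH2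
    norm_num at hH2
    have e : ∫⁻ w, H z w * g w ∂ν = ∫⁻ w, (H z w * h w) ^ (1 / 2 : ℝ) *
        (H z w * (g w ^ 2 / h w)) ^ (1 / 2 : ℝ) ∂ν := by
      refine lintegral_congr_ae ?_
      filter_upwards [h0, htop] with w hw0 hwt
      rw [← ENNReal.mul_rpow_of_nonneg _ _ (by norm_num)]
      have : H z w * h w * (H z w * (g w ^ 2 / h w)) = (H z w * g w) ^ (2 : ℝ) := by
        rw [ENNReal.rpow_two, mul_mul_mul_comm, ENNReal.mul_div_cancel hw0 hwt]; ring
      rw [this, ← ENNReal.rpow_mul]; norm_num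
    rw [e]
    refine (pow_le_pow_left' hH2 2).trans (le_of_eq ?_)
    rw [mul_pow, ← ENNReal.rpow_two, ← ENNReal.rpow_two, ← ENNReal.rpow_mul, ← ENNReal.rpow_mul]
    norm_num
  calc _ ≤ ∫⁻ z, (A * h z) * ∫⁻ w, H z w * (g w ^ 2 / h w) ∂ν ∂ν := by
        refine lintegral_mono_ae ?_
        filter_upwards [hA] with z hz
        exact (hCS z).trans (mul_le_mul_left hz _)
    _ = ∫⁻ z, ∫⁻ w, (A * h z) * (H z w * (g w ^ 2 / h w)) ∂ν ∂ν := by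
        refine lintegral_congr fun z => ?_
        rw [lintegral_const_mul _ (by fun_prop)]
    _ = ∫⁻ w, ∫⁻ z, (A * h z) * (H z w * (g w ^ 2 / h w)) ∂ν ∂ν := by
        refine lintegral_lintegral_swap (Measurable.aemeasurable ?_)
        exact ((hh.comp measurable_fst).const_mul A).mul
          (hH.mul (((hg.pow_const 2).div hh).comp measurable_snd))
    _ = ∫⁻ w, A * (g w ^ 2 / h w) * ∫⁻ z, H z w * h z ∂ν ∂ν := by
        refine lintegral_congr fun w => ?_
        rw [← lintegral_const_mul _ (by fun_prop)]
        refine lintegral_congr fun z => ?_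
        ring
    _ ≤ ∫⁻ w, A * B * g w ^ 2 ∂ν := by
        refine lintegral_mono_ae ?_
        filter_upwards [hB, h0, htop] with w hw hw0 hwt
        refine (mul_le_mul_right hw _).trans (le_of_eq ?_)
        rw [show A * (g w ^ 2 / h w) * (B * h w) = A * B * (g w ^ 2 / h w * h w) by ring,
          ENNReal.div_mul_cancel hw0 hwt]
    _ = _ := lintegral_const_mul _ (hg.pow_const 2)

lemma measurable_poissonInt (μ : Measure ℂ) [IsFiniteMeasure μ] : Measurable (poissonInt μ) := by
  refine Measurable.const_mul (StronglyMeasurable.measurable ?_) _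
  refine StronglyMeasurable.integral_prod_right
    (f := fun z ζ : ℂ => (1 - ‖z‖ ^ 2) / ‖ζ - z‖ ^ 2) (Measurable.stronglyMeasurable ?_)
  unfold Function.uncurry
  fun_prop

lemma measurable_kernH (μ : Measure ℂ) [IsFiniteMeasure μ] (n : ℕ) (α : ℝ) :
    Measurable (Function.uncurry (kernH μ n α)) := by
  have h := measurable_poissonInt μ
  have hconj : Measurable (starRingEnd ℂ) := Complex.continuous_conj.measurable
  unfold Function.uncurry kernH
  fun_prop

lemma integrable_poisson_integrand {μ : Measure ℂ} [IsFiniteMeasure μ]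
    (hμ : ∀ᵐ ζ ∂μ, ‖ζ‖ = 1) {z : ℂ} (hz : ‖z‖ < 1) :
    Integrable (fun ζ => (1 - ‖z‖ ^ 2) / ‖ζ - z‖ ^ 2) μ := by
  refine Integrable.of_bound (C := (1 - ‖z‖ ^ 2) / (1 - ‖z‖) ^ 2)
    (Measurable.aestronglyMeasurable (by fun_prop)) ?_
  filter_upwards [hμ] with ζ hζ
  have h0 := one_sub_norm_sq_pos hz
  have h1 : 0 < 1 - ‖z‖ := by linarith
  have h2 : 1 - ‖z‖ ≤ ‖ζ - z‖ := hζ ▸ norm_sub_norm_le ζ z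
  rw [Real.norm_of_nonneg (by positivity)]
  gcongr

lemma poissonInt_pos {μ : Measure ℂ} [IsFiniteMeasure μ] (hμ : ∀ᵐ ζ ∂μ, ‖ζ‖ = 1)
    (hμ0 : μ ≠ 0) {z : ℂ} (hz : ‖z‖ < 1) : 0 < poissonInt μ z := by
  have h0 := one_sub_norm_sq_pos hz
  refine mul_pos (by have := Real.pi_pos; positivity) ?_
  rw [integral_pos_iff_support_of_nonneg (fun ζ => by positivity)
    (integrable_poisson_integrand hμ hz), pos_iff_ne_zero]
  intro h
  refine hμ0 (ae_eq_bot.1 (Filter.eventually_false_iff_eq_bot.1 ?_))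
  filter_upwards [hμ, measure_eq_zero_iff_ae_notMem.1 h] with ζ hζ hζ'
  refine hζ' ?_
  have : 0 < ‖ζ - z‖ := norm_pos_iff.2 (sub_ne_zero.2 (by rintro rfl; linarith))
  rw [Function.mem_support]
  positivity

lemma ofReal_poissonInt {μ : Measure ℂ} [IsFiniteMeasure μ] (hμ : ∀ᵐ ζ ∂μ, ‖ζ‖ = 1)
    {z : ℂ} (hz : ‖z‖ < 1) :
    ENNReal.ofReal (poissonInt μ z) =
      ∫⁻ ζ, ENNReal.ofReal ((2 * π)⁻¹ * ((1 - ‖z‖ ^ 2) * (‖ζ - z‖ ^ 2)⁻¹)) ∂μ := by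
  have h0 := one_sub_norm_sq_pos hz
  have hpi := Real.pi_pos
  rw [poissonInt, ← integral_const_mul, ofReal_integral_eq_lintegral_ofReal
    ((integrable_poisson_integrand hμ hz).const_mul _)
    (Filter.Eventually.of_forall fun ζ => by simp only [Pi.zero_apply]; positivity)]
  simp only [div_eq_mul_inv]

lemma lintegral_nuMeas (μ : Measure ℂ) [IsFiniteMeasure μ] {f : ℂ → ℝ≥0∞} (hf : Measurable f) :
    ∫⁻ z, f z ∂(nuMeas μ)
      = ∫⁻ z in Metric.ball (0 : ℂ) 1, ENNReal.ofReal (poissonInt μ z) * f z :=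
  lintegral_withDensity_eq_lintegral_mul _ (measurable_poissonInt μ).ennreal_ofReal hf

lemma ae_nuMeas_norm_lt_one (μ : Measure ℂ) : ∀ᵐ z ∂(nuMeas μ), ‖z‖ < 1 := by
  refine (withDensity_absolutelyContinuous _ _).ae_le ?_
  filter_upwards [ae_restrict_mem Metric.isOpen_ball.measurableSet] with z hz
  simpa using hz

instance sFinite_nuMeas (μ : Measure ℂ) : SFinite (nuMeas μ) := by
  unfold nuMeas; infer_instance

/-- The first Schur condition: integration in the second variable, where `P_μ` cancels. -/
lemma exists_schur_bound_right {μ : Measure ℂ} [IsFiniteMeasure μ] (hμ : ∀ᵐ ζ ∂μ, ‖ζ‖ = 1)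
    (hμ0 : μ ≠ 0) (n : ℕ) {α τ : ℝ} (hα : 0 < α) (hτn : τ < n) (hατ : -1 < α + τ) :
    ∃ A : ℝ, 0 < A ∧ ∀ z : ℂ, ‖z‖ < 1 →
      ∫⁻ w, ENNReal.ofReal (kernH μ n α z w) * ENNReal.ofReal ((1 - ‖w‖ ^ 2) ^ τ) ∂(nuMeas μ)
        ≤ ENNReal.ofReal A * ENNReal.ofReal ((1 - ‖z‖ ^ 2) ^ τ) := by
  have hn : (0 : ℝ) ≤ n := n.cast_nonneg
  obtain ⟨A, hA, hFR⟩ := exists_forelliRudin_bound (s := α + τ) (b := n + α + 1) hατ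
    (by linarith) (by linarith)
  refine ⟨A, hA, fun z hz => ?_⟩
  have hz0 := one_sub_norm_sq_pos hz
  have hHz : Measurable (kernH μ n α z) := (measurable_kernH μ n α).of_uncurry_left
  rw [lintegral_nuMeas μ (by fun_prop)]
  calc _ = ∫⁻ w in Metric.ball (0 : ℂ) 1, ENNReal.ofReal ((1 - ‖z‖ ^ 2) ^ (n : ℝ)) *
        ENNReal.ofReal ((1 - ‖w‖ ^ 2) ^ (α + τ) *
          ‖1 - w * conj z‖ ^ (-(n + α + 1 + 1))) := by
        refine setLIntegral_congr_fun Metric.isOpen_ball.measurableSet fun w hw => ?_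
        rw [mem_ball_zero_iff] at hw
        have hw0 := one_sub_norm_sq_pos hw
        have hP := poissonInt_pos hμ hμ0 hw
        have hN := norm_one_sub_mul_conj_pos hz hw
        have hH : 0 ≤ kernH μ n α z w := by unfold kernH; positivity
        rw [← ENNReal.ofReal_mul hH, ← ENNReal.ofReal_mul hP.le,
          ← ENNReal.ofReal_mul (by positivity)]
        congr 1
        have hconj : ‖1 - w * conj z‖ = ‖1 - z * conj w‖ := by
          rw [← RCLike.norm_conj]; simp [mul_comm]
        rw [hconj, Real.rpow_neg hN.le, Real.rpow_add hw0, kernH,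
          show (n : ℝ) + α + 1 + 1 = 2 + n + α by ring]
        field_simp
    _ = ENNReal.ofReal ((1 - ‖z‖ ^ 2) ^ (n : ℝ)) * _ := lintegral_const_mul _ (by fun_prop)
    _ ≤ ENNReal.ofReal ((1 - ‖z‖ ^ 2) ^ (n : ℝ)) * _ := mul_le_mul_right (hFR z hz) _
    _ = _ := by
        rw [← ENNReal.ofReal_mul (by positivity), ← ENNReal.ofReal_mul hA.le, mul_left_comm,
          ← Real.rpow_add hz0]
        congr 3; ring

/-- The second Schur condition: integration in the first variable. -/
lemma exists_schur_bound_left {μ : Measure ℂ} [IsFiniteMeasure μ] (hμ : ∀ᵐ ζ ∂μ, ‖ζ‖ = 1)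
    (hμ0 : μ ≠ 0) (n : ℕ) {α τ : ℝ} (hτn : -1 < n + τ) (hατ : τ + 1 < α) :
    ∃ B : ℝ, 0 < B ∧ ∀ w : ℂ, ‖w‖ < 1 →
      ∫⁻ z, ENNReal.ofReal (kernH μ n α z w) * ENNReal.ofReal ((1 - ‖z‖ ^ 2) ^ τ) ∂(nuMeas μ)
        ≤ ENNReal.ofReal B * ENNReal.ofReal ((1 - ‖w‖ ^ 2) ^ τ) := by
  have hpi := Real.pi_pos
  obtain ⟨B, hB, hFR⟩ := exists_forelliRudin_poisson_bound (s := n + τ + 1) (b := n + α + 1)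
    (by linarith) (by linarith)
  refine ⟨B, hB, fun w hw => ?_⟩
  have hw0 := one_sub_norm_sq_pos hw
  have hP := poissonInt_pos hμ hμ0 hw
  have hHw : Measurable fun z => kernH μ n α z w :=
    (measurable_kernH μ n α).of_uncurry_right
  rw [lintegral_nuMeas μ (by fun_prop)]
  set c : ℝ := (2 * π)⁻¹ * ((1 - ‖w‖ ^ 2) ^ α / poissonInt μ w) with hc
  have hc0 : 0 ≤ c := by positivity
  calc _ = ∫⁻ z in Metric.ball (0 : ℂ) 1, ∫⁻ ζ, ENNReal.ofReal c * ENNReal.ofReal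
        ((1 - ‖z‖ ^ 2) ^ (n + τ + 1) * ‖1 - z * conj w‖ ^ (-(n + α + 1 + 1)) *
          (‖ζ - z‖ ^ 2)⁻¹) ∂μ := by
        refine setLIntegral_congr_fun Metric.isOpen_ball.measurableSet fun z hz => ?_
        rw [mem_ball_zero_iff] at hz
        have hz0 := one_sub_norm_sq_pos hz
        have hN := norm_one_sub_mul_conj_pos hz hw
        have hH : 0 ≤ kernH μ n α z w := by unfold kernH; positivity
        rw [← ENNReal.ofReal_mul hH, ofReal_poissonInt hμ hz,
          ← lintegral_mul_const _ (by fun_prop)]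
        refine lintegral_congr fun ζ => ?_
        rw [← ENNReal.ofReal_mul (by positivity), ← ENNReal.ofReal_mul hc0]
        congr 1
        rw [hc, Real.rpow_neg hN.le, Real.rpow_add_one hz0.ne', Real.rpow_add hz0, kernH,
          show (n : ℝ) + α + 1 + 1 = 2 + n + α by ring]
        simp only [div_eq_mul_inv, mul_inv]
        ring
    _ = ∫⁻ ζ, (∫⁻ z in Metric.ball (0 : ℂ) 1, ENNReal.ofReal c * ENNReal.ofReal
        ((1 - ‖z‖ ^ 2) ^ (n + τ + 1) * ‖1 - z * conj w‖ ^ (-(n + α + 1 + 1)) *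
          (‖ζ - z‖ ^ 2)⁻¹)) ∂μ := by
        refine lintegral_lintegral_swap ?_
        unfold Function.uncurry
        fun_prop
    _ ≤ ∫⁻ ζ, ENNReal.ofReal (B * (1 - ‖w‖ ^ 2) ^ τ / poissonInt μ w) *
        ENNReal.ofReal ((2 * π)⁻¹ * ((1 - ‖w‖ ^ 2) * (‖ζ - w‖ ^ 2)⁻¹)) ∂μ := by
        refine lintegral_mono_ae ?_
        filter_upwards [hμ] with ζ hζ
        rw [lintegral_const_mul _ (by fun_prop)]
        refine (mul_le_mul_right (hFR w hw ζ hζ) _).trans (le_of_eq ?_)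
        rw [← ENNReal.ofReal_mul hc0, ← ENNReal.ofReal_mul (by positivity)]
        congr 1
        have e : (1 - ‖w‖ ^ 2) ^ α * (1 - ‖w‖ ^ 2) ^ (n + τ + 1 + 1 - (n + α + 1))
            = (1 - ‖w‖ ^ 2) ^ τ * (1 - ‖w‖ ^ 2) := by
          rw [← Real.rpow_add hw0, ← Real.rpow_add_one hw0.ne']
          congr 1; ring
        calc _ = (2 * π)⁻¹ * B / poissonInt μ w * (‖ζ - w‖ ^ 2)⁻¹ * ((1 - ‖w‖ ^ 2) ^ α *
              (1 - ‖w‖ ^ 2) ^ (n + τ + 1 + 1 - (n + α + 1))) := by rw [hc]; ring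
          _ = _ := by rw [e]; ring
    _ = _ := by
        rw [lintegral_const_mul _ (by fun_prop), ← ofReal_poissonInt hμ hw,
          ← ENNReal.ofReal_mul (by positivity), ← ENNReal.ofReal_mul hB.le]
        congr 1
        field_simp

/-- Boundedness on `L²(𝔻, dν)` of the positive integral operator
`Tf(z) = ∫_𝔻 H(z,w) f(w) dν(w)`, stated for nonnegative measurable functions
(equivalent to boundedness on `L²(ν)` since the kernel is positive). -/
theorem stmt8 (μ : Measure ℂ) [IsFiniteMeasure μ] (hμ : μ ((Metric.sphere (0:ℂ) 1)ᶜ) = 0)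
    (hμ0 : μ ≠ 0) (n : ℕ) (α σ : ℝ)
    (hσ : σ < (n : ℝ)) (hα1 : σ + 1 < α) (hα2 : -1 < α + σ) :
    ∃ C : ℝ, 0 < C ∧ ∀ g : ℂ → ENNReal, Measurable g →
      (∫⁻ z, (∫⁻ w, ENNReal.ofReal (kernH μ n α z w) * g w ∂(nuMeas μ)) ^ 2 ∂(nuMeas μ))
        ≤ ENNReal.ofReal C * ∫⁻ w, (g w) ^ 2 ∂(nuMeas μ) := by
  have hμ1 : ∀ᵐ ζ ∂μ, ‖ζ‖ = 1 := by
    filter_upwards [measure_eq_zero_iff_ae_notMem.1 hμ] with ζ hζ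
    simpa using hζ
  have hn : (0 : ℝ) ≤ n := n.cast_nonneg
  have hα : 0 < α := by linarith
  -- The Schur weight exponent must also exceed `-1 - n`, which `σ` need not do.
  obtain ⟨τ, hτ, hτ0, hτα⟩ : ∃ τ : ℝ, -1 < τ ∧ τ < 0 ∧ τ + 1 < α := by
    have hm : 0 < min α 1 := lt_min hα one_pos
    exact ⟨min α 1 / 2 - 1, by linarith, by linarith [min_le_right α 1],
      by linarith [min_le_left α 1]⟩
  obtain ⟨A, hA, hAle⟩ := exists_schur_bound_right hμ1 hμ0 n hα (hτ0.trans_le hn)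
    (by linarith)
  obtain ⟨B, hB, hBle⟩ := exists_schur_bound_left hμ1 hμ0 n (by linarith) hτα
  refine ⟨A * B, mul_pos hA hB, fun g hg => ?_⟩
  rw [ENNReal.ofReal_mul hA.le]
  refine lintegral_sq_lintegral_mul_le_of_schur
    (H := fun z w => ENNReal.ofReal (kernH μ n α z w))
    (h := fun z => ENNReal.ofReal ((1 - ‖z‖ ^ 2) ^ τ))
    (measurable_kernH μ n α).ennreal_ofReal (by fun_prop) ?_ (by simp) ?_ ?_ hg
  · filter_upwards [ae_nuMeas_norm_lt_one μ] with z hz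
    have := one_sub_norm_sq_pos hz
    simp only [ne_eq, ENNReal.ofReal_eq_zero, not_le]
    positivity
  · filter_upwards [ae_nuMeas_norm_lt_one μ] with z hz using hAle z hz
  · filter_upwards [ae_nuMeas_norm_lt_one μ] with w hw using hBle w hw
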